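/- Let G be a finite connected simple graph with a bridge e = (u,v), and let G₁ and G₂ be the two connected components of the graph obtained by deleting e (regarded as induced subgraphs of G). Suppose sn(G₁) ≥ sn(G₂), and suppose moreover that if sn(G₁) = sn(G₂) then cart(G₁) ≤ cart(G₂). Then cart(G) = cart(G₁). -/

import Mathlib

open SimpleGraph

universe u


/-- An egg of a graph `G`: a nonempty set of vertices inducing a connected subgraph. -/
def SimpleGraph.IsEgg {V : Type u} (G : SimpleGraph V) (A : Finset V) : Prop :=
  A.Nonempty ∧ (G.induce (A : Set V)).Connected

/-- A scramble on `G`: a nonempty finite collection of eggs. -/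
def SimpleGraph.IsScramble {V : Type u} (G : SimpleGraph V) (S : Finset (Finset V)) : Prop :=
  S.Nonempty ∧ ∀ A ∈ S, G.IsEgg A

/-- The hitting number `h(S)`: the minimum cardinality of a set of vertices meeting
every egg of `S`. -/
noncomputable def hittingNumber {V : Type u} (S : Finset (Finset V)) : ℕ :=
  sInf {n | ∃ H : Finset V, H.card = n ∧ ∀ A ∈ S, ∃ x ∈ H, x ∈ A}

/-- The number of edges of `G` with one endpoint in `A` and the other outside of `A`. -/
noncomputable def cutSize {V : Type u} (G : SimpleGraph V) (A : Set V) : ℕ :=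
  Set.ncard {e : Sym2 V | ∃ u v, e = s(u, v) ∧ G.Adj u v ∧ u ∈ A ∧ v ∉ A}

/-- An egg-cut for a scramble `S`: a vertex subset `A` containing some egg of `S` and
whose complement contains some egg of `S`. -/
def IsEggCut {V : Type u} (S : Finset (Finset V)) (A : Set V) : Prop :=
  (∃ B ∈ S, (B : Set V) ⊆ A) ∧ (∃ B ∈ S, (B : Set V) ⊆ Aᶜ)

/-- The egg-cut number `e(S)` (in `ℕ∞`): the minimum size of an egg-cut for `S`,
or `⊤` if no egg-cut exists. -/
noncomputable def eggCutNumber {V : Type u} (G : SimpleGraph V) (S : Finset (Finset V)) : ℕ∞ :=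
  sInf {n : ℕ∞ | ∃ A : Set V, IsEggCut S A ∧ n = (cutSize G A : ℕ∞)}

/-- The order `‖S‖` of a scramble: the minimum of its hitting number and
its egg-cut number. -/
noncomputable def scrambleOrder {V : Type u} (G : SimpleGraph V) (S : Finset (Finset V)) : ℕ∞ :=
  min (hittingNumber S : ℕ∞) (eggCutNumber G S)

/-- The scramble number `sn(G)`: the maximum order of a scramble on `G`. -/
noncomputable def scrambleNumber {V : Type u} (G : SimpleGraph V) : ℕ :=
  sSup {n | ∃ S : Finset (Finset V), G.IsScramble S ∧ scrambleOrder G S = (n : ℕ∞)}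

/-- A disjoint scramble: a scramble whose eggs are pairwise disjoint. -/
def IsDisjointScramble {V : Type u} (G : SimpleGraph V) (S : Finset (Finset V)) : Prop :=
  G.IsScramble S ∧ (S : Set (Finset V)).Pairwise fun A B => Disjoint (A : Set V) (B : Set V)

/-- The disjoint scramble number `dsn(G)`: the maximum order of a disjoint scramble on `G`. -/
noncomputable def disjointScrambleNumber {V : Type u} (G : SimpleGraph V) : ℕ :=
  sSup {n | ∃ S : Finset (Finset V), IsDisjointScramble G S ∧ scrambleOrder G S = (n : ℕ∞)}

/-- The carton number `cart(G)`: the minimum size (number of eggs) of a scramble on `G`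
whose order equals the scramble number of `G`. -/
noncomputable def cartonNumber {V : Type u} (G : SimpleGraph V) : ℕ :=
  sInf {n | ∃ S : Finset (Finset V), G.IsScramble S ∧
    scrambleOrder G S = (scrambleNumber G : ℕ∞) ∧ S.card = n}

/-- The maximum degree of a graph. -/
noncomputable def maxDeg {V : Type u} (G : SimpleGraph V) : ℕ :=
  sSup {n | ∃ v : V, (G.neighborSet v).ncard = n}

section Connectivity

variable {V : Type u} {G : SimpleGraph V}

theorem connected_iff_exists_crossing : G.Connected ↔ Nonempty V ∧
    ∀ X : Set V, X.Nonempty → Xᶜ.Nonempty → ∃ a ∈ X, ∃ b ∉ X, G.Adj a b := by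
  constructor
  · intro h
    refine ⟨h.nonempty, ?_⟩
    rintro X ⟨x, hx⟩ ⟨y, hy⟩
    obtain ⟨p⟩ := h.preconnected x y
    obtain ⟨d, -, hd, hd'⟩ := p.exists_boundary_dart X hx hy
    exact ⟨d.fst, hd, d.snd, hd', d.adj⟩
  · rintro ⟨hne, h⟩
    refine (connected_iff G).2 ⟨fun x y => ?_, hne⟩
    by_contra hxy
    obtain ⟨a, ha, b, hb, hab⟩ := h {z | G.Reachable x z} ⟨x, Reachable.refl x⟩ ⟨y, hxy⟩
    exact hb (Reachable.trans ha hab.reachable)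

theorem SimpleGraph.isEgg_iff_exists_crossing {E : Finset V} : G.IsEgg E ↔ E.Nonempty ∧
    ∀ X : Set V, (∃ x ∈ E, x ∈ X) → (∃ y ∈ E, y ∉ X) →
      ∃ a ∈ E, ∃ b ∈ E, a ∈ X ∧ b ∉ X ∧ G.Adj a b := by
  unfold SimpleGraph.IsEgg
  rw [connected_iff_exists_crossing]
  refine and_congr_right fun hne => ⟨?_, ?_⟩
  · rintro ⟨-, h⟩ X ⟨x, hxE, hx⟩ ⟨y, hyE, hy⟩
    obtain ⟨a, ha, b, hb, hab⟩ := h (Subtype.val ⁻¹' X) ⟨⟨x, hxE⟩, hx⟩ ⟨⟨y, hyE⟩, hy⟩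
    exact ⟨a, a.2, b, b.2, ha, hb, hab⟩
  · intro h
    refine ⟨hne.to_subtype, ?_⟩
    rintro X ⟨x, hx⟩ ⟨y, hy⟩
    obtain ⟨a, haE, b, hbE, ⟨a', ha', rfl⟩, hb, hab⟩ := h (Subtype.val '' X)
      ⟨x, x.2, x, hx, rfl⟩ ⟨y, y.2, by rintro ⟨z, hz, hzy⟩; exact hy (Subtype.ext hzy ▸ hz)⟩
    exact ⟨a', ha', ⟨b, hbE⟩, fun hbX => hb ⟨_, hbX, rfl⟩, hab⟩

end Connectivity

section Scramble

variable {V : Type u} {G : SimpleGraph V} {S : Finset (Finset V)}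

theorem le_hittingNumber_iff (hS : G.IsScramble S) {n : ℕ} :
    n ≤ hittingNumber S ↔ ∀ H : Finset V, (∀ A ∈ S, ∃ x ∈ H, x ∈ A) → n ≤ H.card := by
  classical
  constructor
  · intro h H hH
    exact h.trans (Nat.sInf_le ⟨H, rfl, hH⟩)
  · intro h
    refine le_csInf ⟨_, S.biUnion id, rfl, fun A hA => ?_⟩ ?_
    · obtain ⟨x, hx⟩ := (hS.2 A hA).1
      exact ⟨x, Finset.mem_biUnion.2 ⟨A, hA, hx⟩, hx⟩
    · rintro _ ⟨H, rfl, hH⟩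
      exact h H hH

theorem natCast_le_scrambleOrder_iff (hS : G.IsScramble S) {n : ℕ} :
    (n : ℕ∞) ≤ scrambleOrder G S ↔
      (∀ H : Finset V, (∀ A ∈ S, ∃ x ∈ H, x ∈ A) → n ≤ H.card) ∧
        ∀ A : Set V, IsEggCut S A → n ≤ cutSize G A := by
  unfold scrambleOrder eggCutNumber
  rw [le_min_iff, Nat.cast_le, le_hittingNumber_iff hS, le_sInf_iff]
  refine and_congr_right fun _ => ⟨fun h A hA => ?_, ?_⟩
  · exact_mod_cast h _ ⟨A, hA, rfl⟩
  · rintro h _ ⟨A, hA, rfl⟩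
    exact_mod_cast h A hA

theorem scrambleOrder_ne_top : scrambleOrder G S ≠ ⊤ :=
  ne_top_of_le_ne_top (ENat.natCast_ne_top _) (min_le_left _ _)

theorem isScramble_singleton_singleton (x : V) : G.IsScramble {{x}} := by
  refine ⟨Finset.singleton_nonempty _, fun A hA => ?_⟩
  rw [Finset.mem_singleton.1 hA, isEgg_iff_exists_crossing]
  refine ⟨Finset.singleton_nonempty _, ?_⟩
  simp only [Finset.mem_singleton, exists_eq_left]
  exact fun X hx hy => absurd hx hy

theorem one_le_scrambleOrder_singleton_singleton (x : V) :
    ((1 : ℕ) : ℕ∞) ≤ scrambleOrder G {{x}} := by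
  rw [natCast_le_scrambleOrder_iff (isScramble_singleton_singleton x)]
  constructor
  · intro H hH
    obtain ⟨y, hy, -⟩ := hH _ (Finset.mem_singleton_self _)
    exact Finset.card_pos.2 ⟨y, hy⟩
  · rintro A ⟨⟨B, hB, hBA⟩, C, hC, hCA⟩
    rw [Finset.mem_singleton.1 hB, Finset.coe_singleton, Set.singleton_subset_iff] at hBA
    rw [Finset.mem_singleton.1 hC, Finset.coe_singleton, Set.singleton_subset_iff] at hCA
    exact absurd hBA hCA

variable [Finite V]

theorem bddAbove_scrambleOrder : BddAbove
    {n : ℕ | ∃ S : Finset (Finset V), G.IsScramble S ∧ scrambleOrder G S = (n : ℕ∞)} := by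
  cases nonempty_fintype V
  refine ⟨Fintype.card V, ?_⟩
  rintro n ⟨S, hS, hn⟩
  refine ((natCast_le_scrambleOrder_iff hS).1 hn.ge).1 Finset.univ fun A hA => ?_
  obtain ⟨x, hx⟩ := (hS.2 A hA).1
  exact ⟨x, Finset.mem_univ x, hx⟩

theorem scrambleOrder_le_scrambleNumber (hS : G.IsScramble S) :
    scrambleOrder G S ≤ scrambleNumber G := by
  obtain ⟨n, hn⟩ := ENat.ne_top_iff_exists.1 (scrambleOrder_ne_top (G := G) (S := S))
  rw [← hn, Nat.cast_le]
  exact le_csSup bddAbove_scrambleOrder ⟨S, hS, hn.symm⟩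

theorem cartonNumber_le_card (hS : G.IsScramble S)
    (h : (scrambleNumber G : ℕ∞) ≤ scrambleOrder G S) : cartonNumber G ≤ S.card :=
  Nat.sInf_le ⟨S, hS, le_antisymm (scrambleOrder_le_scrambleNumber hS) h, rfl⟩

variable (G) [Nonempty V]

theorem one_le_scrambleNumber : 1 ≤ scrambleNumber G := by
  obtain ⟨x⟩ := ‹Nonempty V›
  exact_mod_cast (one_le_scrambleOrder_singleton_singleton x).trans
    (scrambleOrder_le_scrambleNumber (isScramble_singleton_singleton (G := G) x))

theorem exists_card_eq_cartonNumber : ∃ S : Finset (Finset V), G.IsScramble S ∧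
    scrambleOrder G S = scrambleNumber G ∧ S.card = cartonNumber G := by
  obtain ⟨x⟩ := ‹Nonempty V›
  obtain ⟨n, hn⟩ := ENat.ne_top_iff_exists.1 (scrambleOrder_ne_top (G := G) (S := {{x}}))
  have hne : {n : ℕ | ∃ S : Finset (Finset V), G.IsScramble S ∧
      scrambleOrder G S = (n : ℕ∞)}.Nonempty :=
    ⟨n, _, isScramble_singleton_singleton x, hn.symm⟩
  obtain ⟨S, hS, hSn⟩ := Nat.sSup_mem hne bddAbove_scrambleOrder
  exact Nat.sInf_mem (s := {n | ∃ S : Finset (Finset V), G.IsScramble S ∧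
    scrambleOrder G S = (scrambleNumber G : ℕ∞) ∧ S.card = n}) ⟨_, S, hS, hSn, rfl⟩

theorem one_le_cartonNumber : 1 ≤ cartonNumber G := by
  obtain ⟨S, hS, -, hcard⟩ := exists_card_eq_cartonNumber G
  exact hcard ▸ Finset.card_pos.2 hS.1

variable {G} in
theorem cartonNumber_eq_one (h : scrambleNumber G = 1) : cartonNumber G = 1 := by
  refine le_antisymm ?_ (one_le_cartonNumber G)
  obtain ⟨x⟩ := ‹Nonempty V›
  refine (cartonNumber_le_card (isScramble_singleton_singleton x) ?_).trans
    (Finset.card_singleton _).le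
  rw [h]
  exact one_le_scrambleOrder_singleton_singleton x

end Scramble

section Extend

variable {V : Type u} {G : SimpleGraph V} {A : Set V}

/-- A scramble on an induced subgraph, regarded as a scramble on the whole graph. -/
def extendScramble (S : Finset (Finset A)) : Finset (Finset V) :=
  S.map (Finset.mapEmbedding (Function.Embedding.subtype (· ∈ A))).toEmbedding

theorem mem_extendScramble {S : Finset (Finset A)} {E : Finset V} : E ∈ extendScramble S ↔
    ∃ F ∈ S, F.map (Function.Embedding.subtype (· ∈ A)) = E := by
  simp [extendScramble]

theorem card_extendScramble (S : Finset (Finset A)) : (extendScramble S).card = S.card :=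
  Finset.card_map _

theorem isScramble_extendScramble {S : Finset (Finset A)} (hS : (G.induce A).IsScramble S) :
    G.IsScramble (extendScramble S) := by
  refine ⟨hS.1.map, fun E hE => ?_⟩
  obtain ⟨F, hF, rfl⟩ := mem_extendScramble.1 hE
  obtain ⟨hne, h⟩ := isEgg_iff_exists_crossing.1 (hS.2 F hF)
  refine isEgg_iff_exists_crossing.2 ⟨hne.map, ?_⟩
  simp only [Finset.mem_map, Function.Embedding.subtype_apply]
  rintro X ⟨_, ⟨x, hx, rfl⟩, hxX⟩ ⟨_, ⟨y, hy, rfl⟩, hyX⟩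
  obtain ⟨a, ha, b, hb, haX, hbX, hab⟩ := h (Subtype.val ⁻¹' X) ⟨x, hx, hxX⟩ ⟨y, hy, hyX⟩
  exact ⟨a, ⟨a, ha, rfl⟩, b, ⟨b, hb, rfl⟩, haX, hbX, hab⟩

theorem cutSize_preimage_val_le [Finite V] (X : Set V) :
    cutSize (G.induce A) (Subtype.val ⁻¹' X) ≤ cutSize G X := by
  refine Set.ncard_le_ncard_of_injOn (Sym2.map Subtype.val) ?_
    (Sym2.map.injective Subtype.val_injective).injOn
  rintro _ ⟨a, b, rfl, hab, ha, hb⟩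
  exact ⟨a, b, rfl, hab, ha, hb⟩

theorem scrambleOrder_le_extendScramble [Finite V] {S : Finset (Finset A)}
    (hS : (G.induce A).IsScramble S) :
    scrambleOrder (G.induce A) S ≤ scrambleOrder G (extendScramble S) := by
  classical
  obtain ⟨n, hn⟩ := ENat.ne_top_iff_exists.1 (scrambleOrder_ne_top (G := G.induce A) (S := S))
  obtain ⟨hhit, hcut⟩ := (natCast_le_scrambleOrder_iff hS).1 hn.le
  rw [← hn, natCast_le_scrambleOrder_iff (isScramble_extendScramble hS)]
  constructor
  · intro H hH
    refine (hhit (H.subtype (· ∈ A)) fun F hF => ?_).trans ?_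
    · obtain ⟨_, hxH, hx⟩ := hH _ (mem_extendScramble.2 ⟨F, hF, rfl⟩)
      obtain ⟨x, hxF, rfl⟩ := Finset.mem_map.1 hx
      exact ⟨x, Finset.mem_subtype.2 hxH, hxF⟩
    · rw [Finset.card_subtype]
      exact Finset.card_filter_le _ _
  · rintro X ⟨⟨_, hE, hEX⟩, _, hE', hEX'⟩
    obtain ⟨F, hF, rfl⟩ := mem_extendScramble.1 hE
    obtain ⟨F', hF', rfl⟩ := mem_extendScramble.1 hE'
    refine (hcut _ ⟨⟨F, hF, fun x hx => ?_⟩, F', hF', fun x hx => ?_⟩).trans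
      (cutSize_preimage_val_le X)
    · exact hEX (Finset.mem_coe.2 (Finset.mem_map.2 ⟨x, hx, rfl⟩))
    · exact hEX' (Finset.mem_coe.2 (Finset.mem_map.2 ⟨x, hx, rfl⟩))

theorem scrambleNumber_induce_le [Finite V] [Nonempty A] :
    scrambleNumber (G.induce A) ≤ scrambleNumber G := by
  obtain ⟨S, hS, hSn, -⟩ := exists_card_eq_cartonNumber (G.induce A)
  exact_mod_cast hSn ▸ (scrambleOrder_le_extendScramble hS).trans
    (scrambleOrder_le_scrambleNumber (isScramble_extendScramble hS))

end Extend

section Restrict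

open Classical in
/-- The map to `A` fixing the points of `A` and sending all other points to `u`. -/
noncomputable def collapse {V : Type u} {A : Set V} (u : A) (x : V) : A :=
  if h : x ∈ A then ⟨x, h⟩ else u

open Classical in
/-- The traces on `A` of the eggs of a scramble. -/
noncomputable def restrictScramble {V : Type u} (A : Set V) (S : Finset (Finset V)) :
    Finset (Finset A) :=
  S.image (Finset.subtype (· ∈ A))

variable {V : Type u} {G : SimpleGraph V} {A : Set V} {u : A}

theorem collapse_coe (x : A) : collapse u x = x := dif_pos x.2

theorem collapse_of_notMem {x : V} (hx : x ∉ A) : collapse u x = u := dif_neg hx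

theorem mem_restrictScramble {S : Finset (Finset V)} {F : Finset A} :
    F ∈ restrictScramble A S ↔ ∃ E ∈ S, ∀ x : A, x ∈ F ↔ (x : V) ∈ E := by
  classical
  rw [restrictScramble, Finset.mem_image]
  refine exists_congr fun E => and_congr_right fun _ => ?_
  rw [Finset.ext_iff]
  simp only [Finset.mem_subtype]
  exact forall_congr' fun x => Iff.comm

theorem mem_of_adj_of_collapse_ne (hA : ∀ x ∈ A, ∀ y ∉ A, G.Adj x y → x = u) {a b : V}
    (hab : G.Adj a b) (hne : collapse u a ≠ collapse u b) : a ∈ A ∧ b ∈ A := by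
  by_cases ha : a ∈ A <;> by_cases hb : b ∈ A
  · exact ⟨ha, hb⟩
  · obtain rfl := hA a ha b hb hab
    exact absurd ((collapse_coe u).trans (collapse_of_notMem hb).symm) hne
  · obtain rfl := hA b hb a ha hab.symm
    exact absurd ((collapse_of_notMem ha).trans (collapse_coe u).symm) hne
  · exact absurd ((collapse_of_notMem ha).trans (collapse_of_notMem hb).symm) hne

theorem collapse_mem_of_isEgg (hA : ∀ x ∈ A, ∀ y ∉ A, G.Adj x y → x = u) {E : Finset V}
    (hE : G.IsEgg E) (hEA : ∃ x ∈ E, x ∈ A) {x : V} (hx : x ∈ E) : (collapse u x : V) ∈ E := by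
  by_cases hxA : x ∈ A
  · rwa [show collapse u x = ⟨x, hxA⟩ from dif_pos hxA]
  · rw [collapse_of_notMem hxA]
    obtain ⟨a, ha, b, hb, haA, hbA, hab⟩ :=
      (isEgg_iff_exists_crossing.1 hE).2 A hEA ⟨x, hx, hxA⟩
    exact hA a haA b hbA hab ▸ ha

theorem isScramble_restrictScramble (hA : ∀ x ∈ A, ∀ y ∉ A, G.Adj x y → x = u)
    {S : Finset (Finset V)} (hS : G.IsScramble S) (hSA : ∀ E ∈ S, ∃ x ∈ E, x ∈ A) :
    (G.induce A).IsScramble (restrictScramble A S) := by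
  classical
  refine ⟨hS.1.image _, fun F hF => ?_⟩
  obtain ⟨E, hE, hFE⟩ := mem_restrictScramble.1 hF
  rw [isEgg_iff_exists_crossing]
  constructor
  · obtain ⟨x, hx, hxA⟩ := hSA E hE
    exact ⟨⟨x, hxA⟩, (hFE _).2 hx⟩
  · rintro X ⟨x, hxF, hx⟩ ⟨y, hyF, hy⟩
    obtain ⟨a, haE, b, hbE, ha, hb, hab⟩ := (isEgg_iff_exists_crossing.1 (hS.2 E hE)).2
      (collapse u ⁻¹' X) ⟨x, (hFE x).1 hxF, by rwa [Set.mem_preimage, collapse_coe]⟩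
      ⟨y, (hFE y).1 hyF, by rwa [Set.mem_preimage, collapse_coe]⟩
    obtain ⟨haA, hbA⟩ := mem_of_adj_of_collapse_ne hA hab fun h =>
    hb (by rwa [Set.mem_preimage, ← h])
    lift a to A using haA
    lift b to A using hbA
    rw [Set.mem_preimage, collapse_coe] at ha hb
    exact ⟨a, (hFE a).2 haE, b, (hFE b).2 hbE, ha, hb, hab⟩

theorem cutSize_preimage_collapse_le [Finite V] (hA : ∀ x ∈ A, ∀ y ∉ A, G.Adj x y → x = u)
    (X : Set A) : cutSize G (collapse u ⁻¹' X) ≤ cutSize (G.induce A) X := by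
  refine le_trans (Set.ncard_le_ncard ?_) (Set.ncard_image_le (f := Sym2.map Subtype.val))
  rintro _ ⟨a, b, rfl, hab, ha, hb⟩
  obtain ⟨haA, hbA⟩ := mem_of_adj_of_collapse_ne hA hab fun h =>
    hb (by rwa [Set.mem_preimage, ← h])
  lift a to A using haA
  lift b to A using hbA
  rw [Set.mem_preimage, collapse_coe] at ha hb
  exact ⟨s(a, b), ⟨a, b, rfl, hab, ha, hb⟩, rfl⟩

theorem scrambleOrder_le_restrictScramble [Finite V]
    (hA : ∀ x ∈ A, ∀ y ∉ A, G.Adj x y → x = u) {S : Finset (Finset V)} (hS : G.IsScramble S)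
    (hSA : ∀ E ∈ S, ∃ x ∈ E, x ∈ A) :
    scrambleOrder G S ≤ scrambleOrder (G.induce A) (restrictScramble A S) := by
  classical
  obtain ⟨n, hn⟩ := ENat.ne_top_iff_exists.1 (scrambleOrder_ne_top (G := G) (S := S))
  obtain ⟨hhit, hcut⟩ := (natCast_le_scrambleOrder_iff hS).1 hn.le
  rw [← hn, natCast_le_scrambleOrder_iff (isScramble_restrictScramble hA hS hSA)]
  constructor
  · intro H hH
    refine (hhit (H.map (Function.Embedding.subtype _)) fun E hE => ?_).trans_eq
      (Finset.card_map _)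
    obtain ⟨x, hxH, hx⟩ := hH _ (Finset.mem_image_of_mem _ hE)
    exact ⟨x, Finset.mem_map.2 ⟨x, hxH, rfl⟩, Finset.mem_subtype.1 hx⟩
  · rintro X ⟨⟨F, hF, hFX⟩, F', hF', hFX'⟩
    obtain ⟨E, hE, hFE⟩ := mem_restrictScramble.1 hF
    obtain ⟨E', hE', hFE'⟩ := mem_restrictScramble.1 hF'
    refine (hcut (collapse u ⁻¹' X) ⟨⟨E, hE, fun x hx => ?_⟩, E', hE', fun x hx => ?_⟩).trans
      (cutSize_preimage_collapse_le hA X)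
    · exact hFX ((hFE _).2 (collapse_mem_of_isEgg hA (hS.2 E hE) (hSA E hE) hx))
    · exact hFX' ((hFE' _).2 (collapse_mem_of_isEgg hA (hS.2 E' hE') (hSA E' hE') hx))

theorem scrambleNumber_cartonNumber_induce_of_forall_meets [Finite V]
    (hA : ∀ x ∈ A, ∀ y ∉ A, G.Adj x y → x = u) {S : Finset (Finset V)} (hS : G.IsScramble S)
    (hSn : scrambleOrder G S = scrambleNumber G) (hSA : ∀ E ∈ S, ∃ x ∈ E, x ∈ A) :
    scrambleNumber (G.induce A) = scrambleNumber G ∧ cartonNumber (G.induce A) ≤ S.card := by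
  classical
  have : Nonempty A := ⟨u⟩
  have hS' := isScramble_restrictScramble hA hS hSA
  have hle := hSn ▸ scrambleOrder_le_restrictScramble hA hS hSA
  have heq : scrambleNumber (G.induce A) = scrambleNumber G :=
    scrambleNumber_induce_le.antisymm
      (by exact_mod_cast hle.trans (scrambleOrder_le_scrambleNumber hS'))
  exact ⟨heq, (cartonNumber_le_card hS' (heq ▸ hle)).trans Finset.card_image_le⟩

end Restrict

section Bridge

variable {V : Type u} {G : SimpleGraph V} {u v : V}

theorem eq_of_adj_of_reachable_deleteEdges
    (hbridge : ¬ (G.deleteEdges {s(u, v)}).Reachable u v) {x y : V}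
    (hx : (G.deleteEdges {s(u, v)}).Reachable u x)
    (hy : ¬ (G.deleteEdges {s(u, v)}).Reachable u y) (hxy : G.Adj x y) : x = u ∧ y = v := by
  by_cases h : s(x, y) = s(u, v)
  · rcases Sym2.eq_iff.1 h with h | ⟨rfl, rfl⟩
    · exact h
    · exact absurd hx hbridge
  · exact absurd (hx.trans (Adj.reachable (deleteEdges_adj.2 ⟨hxy, h⟩))) hy

theorem reachable_or_reachable_deleteEdges (hconn : G.Connected) (w : V) :
    (G.deleteEdges {s(u, v)}).Reachable u w ∨ (G.deleteEdges {s(u, v)}).Reachable v w := by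
  by_contra hw
  obtain ⟨a, ha, b, hb, hab⟩ := (connected_iff_exists_crossing.1 hconn).2
    {w | (G.deleteEdges {s(u, v)}).Reachable u w ∨ (G.deleteEdges {s(u, v)}).Reachable v w}
    ⟨u, Or.inl (Reachable.refl u)⟩ ⟨w, hw⟩
  by_cases h : s(a, b) = s(u, v)
  · rcases Sym2.eq_iff.1 h with ⟨-, rfl⟩ | ⟨-, rfl⟩
    · exact hb (Or.inr (Reachable.refl _))
    · exact hb (Or.inl (Reachable.refl _))
  · have hr : (G.deleteEdges {s(u, v)}).Reachable a b :=
      Adj.reachable (deleteEdges_adj.2 ⟨hab, h⟩)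
    exact hb (ha.imp (·.trans hr) (·.trans hr))

theorem cutSize_reachable_deleteEdges_le_one
    (hbridge : ¬ (G.deleteEdges {s(u, v)}).Reachable u v) :
    cutSize G {w | (G.deleteEdges {s(u, v)}).Reachable u w} ≤ 1 := by
  refine (Set.ncard_le_ncard ?_ (Set.finite_singleton s(u, v))).trans (Set.ncard_singleton _).le
  rintro _ ⟨a, b, rfl, hab, ha, hb⟩
  obtain ⟨rfl, rfl⟩ := eq_of_adj_of_reachable_deleteEdges hbridge ha hb hab
  rfl

theorem forall_meets_or_forall_meets (hconn : G.Connected)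
    (hbridge : ¬ (G.deleteEdges {s(u, v)}).Reachable u v) {S : Finset (Finset V)}
    (hS : G.IsScramble S) (hS2 : ((2 : ℕ) : ℕ∞) ≤ scrambleOrder G S) :
    (∀ E ∈ S, ∃ x ∈ E, x ∈ {w | (G.deleteEdges {s(u, v)}).Reachable u w}) ∨
      ∀ E ∈ S, ∃ x ∈ E, x ∈ {w | (G.deleteEdges {s(u, v)}).Reachable v w} := by
  by_contra! h
  obtain ⟨⟨E, hE, hEu⟩, E', hE', hEv⟩ := h
  have h2 := ((natCast_le_scrambleOrder_iff hS).1 hS2).2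
    {w | (G.deleteEdges {s(u, v)}).Reachable u w}
    ⟨⟨E', hE', fun x hx => (reachable_or_reachable_deleteEdges hconn x).resolve_right (hEv x hx)⟩,
      E, hE, hEu⟩
  exact absurd (h2.trans (cutSize_reachable_deleteEdges_le_one hbridge)) (by decide)

end Bridge

/-- Let `G` be a finite connected simple graph with a bridge `uv`, and
let `G₁`, `G₂` be the induced subgraphs of `G` on the two components (the sets of
vertices reachable from `u`, resp. `v`, after deleting the bridge). If
`sn(G₁) ≥ sn(G₂)`, and `cart(G₁) ≤ cart(G₂)` in case `sn(G₁) = sn(G₂)`, then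
`cart(G) = cart(G₁)`. -/
theorem carton_of_bridge {V : Type u} [Fintype V] (G : SimpleGraph V)
    (hconn : G.Connected) (u v : V) (huv : G.Adj u v)
    (hbridge : ¬ (G.deleteEdges {s(u, v)}).Reachable u v)
    (G₁ : SimpleGraph {w : V | (G.deleteEdges {s(u, v)}).Reachable u w})
    (G₂ : SimpleGraph {w : V | (G.deleteEdges {s(u, v)}).Reachable v w})
    (hG₁ : G₁ = G.induce {w : V | (G.deleteEdges {s(u, v)}).Reachable u w})
    (hG₂ : G₂ = G.induce {w : V | (G.deleteEdges {s(u, v)}).Reachable v w})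
    (hsn : scrambleNumber G₂ ≤ scrambleNumber G₁)
    (hcart : scrambleNumber G₁ = scrambleNumber G₂ → cartonNumber G₁ ≤ cartonNumber G₂) :
    cartonNumber G = cartonNumber G₁ := by
  subst hG₁ hG₂
  have hbridge' : ¬ (G.deleteEdges {s(u, v)}).Reachable v u := fun h => hbridge h.symm
  let u' : {w : V | (G.deleteEdges {s(u, v)}).Reachable u w} := ⟨u, Reachable.refl u⟩
  let v' : {w : V | (G.deleteEdges {s(u, v)}).Reachable v w} := ⟨v, Reachable.refl v⟩
  have : Nonempty V := ⟨u⟩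
  have : Nonempty {w : V | (G.deleteEdges {s(u, v)}).Reachable u w} := ⟨u'⟩
  obtain ⟨S, hS, hSn, hcard⟩ := exists_card_eq_cartonNumber G
  have hle := scrambleNumber_induce_le (G := G)
    (A := {w : V | (G.deleteEdges {s(u, v)}).Reachable u w})
  rcases (one_le_scrambleNumber G).eq_or_lt with h1 | h2
  · rw [cartonNumber_eq_one h1.symm, cartonNumber_eq_one]
    exact (hle.trans h1.ge).antisymm (one_le_scrambleNumber _)
  have hmain : scrambleNumber (G.induce {w : V | (G.deleteEdges {s(u, v)}).Reachable u w}) =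
      scrambleNumber G ∧
      cartonNumber (G.induce {w : V | (G.deleteEdges {s(u, v)}).Reachable u w}) ≤
        cartonNumber G := by
    rw [← hcard]
    rcases forall_meets_or_forall_meets hconn hbridge hS
      (hSn ▸ Nat.cast_le.2 h2) with hmeet | hmeet
    · exact scrambleNumber_cartonNumber_induce_of_forall_meets (u := u')
        (fun x hx y hy hxy => (eq_of_adj_of_reachable_deleteEdges hbridge hx hy hxy).1)
        hS hSn hmeet
    · obtain ⟨hn, hc⟩ := scrambleNumber_cartonNumber_induce_of_forall_meets (u := v')
        (fun x hx y hy hxy => by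
          rw [Set.mem_ofPred_eq, Sym2.eq_swap] at hx hy
          exact (eq_of_adj_of_reachable_deleteEdges (Sym2.eq_swap ▸ hbridge') hx hy hxy).1)
        hS hSn hmeet
      have heq := hle.antisymm (hn ▸ hsn)
      exact ⟨heq, (hcart (heq.trans hn.symm)).trans hc⟩
  obtain ⟨heq, hge⟩ := hmain
  obtain ⟨T, hT, hTn, hTcard⟩ := exists_card_eq_cartonNumber
    (G.induce {w : V | (G.deleteEdges {s(u, v)}).Reachable u w})
  refine le_antisymm ?_ hge
  rw [← hTcard, ← card_extendScramble]
  refine cartonNumber_le_card (isScramble_extendScramble hT) ?_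
  rw [← heq, ← hTn]
  exact scrambleOrder_le_extendScramble hT
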